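/- Let λ ∈ (0,1). The Poisson pmf p(y) = (λ^y/y!) e^{-λ} on ℕ satisfies p(0) + p(1) + ∑_{y≥2} p(y) = 1 and ∑_{y≥2} p(y) = 1 − (1+λ)e^{-λ}, and moreover 1 − (1+λ)e^{-λ} equals the total mass that the inter-decode-time variable X places on {2, 3, …}, i.e., ∑_{x=2}^∞ ((x-1)^{x-2}/(x(x-2)!)) λ^x e^{-xλ} = 1 − (1+λ) e^{-λ}. -/

import Mathlib

lemma aux_exp (x : ℝ) : HasSum (fun n : ℕ => x ^ n / (n.factorial : ℝ)) (Real.exp x) := by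
  rw [Real.exp_eq_exp_ℝ]
  exact NormedSpace.expSeries_div_hasSum_exp x

noncomputable def cc (m : ℕ) : ℝ := (m : ℝ) ^ m / ((m + 1).factorial : ℝ)

lemma cc_nonneg (m : ℕ) : 0 ≤ cc m := by unfold cc; positivity

lemma cc_le (m : ℕ) : cc m ≤ Real.exp 1 ^ m := by
  have h := Real.pow_div_factorial_le_exp (m : ℝ) (by positivity) m
  rw [← Real.exp_nat_mul, mul_one]
  refine le_trans ?_ h
  unfold cc
  gcongr
  omega

noncomputable def PP : FormalMultilinearSeries ℝ ℝ ℝ := FormalMultilinearSeries.ofScalars ℝ cc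

noncomputable def rr : NNReal := ⟨Real.exp (-1), (Real.exp_pos _).le⟩

lemma PP_radius : (rr : ENNReal) ≤ PP.radius := by
  apply FormalMultilinearSeries.le_radius_of_bound _ 1
  intro n
  unfold PP
  rw [FormalMultilinearSeries.ofScalars_norm, Real.norm_of_nonneg (cc_nonneg n)]
  have : (rr : ℝ) = Real.exp (-1) := rfl
  rw [this]
  calc cc n * Real.exp (-1) ^ n ≤ Real.exp 1 ^ n * Real.exp (-1) ^ n := by
        gcongr; exact cc_le n
    _ = 1 := by rw [← mul_pow, ← Real.exp_add]; simp

lemma PP_ball : HasFPowerSeriesOnBall PP.sum PP 0 rr := by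
  have hp : (0 : ENNReal) < rr := by
    have : (0 : NNReal) < rr := Real.exp_pos (-1)
    exact_mod_cast this
  exact (PP.hasFPowerSeriesOnBall (hp.trans_le PP_radius)).mono hp PP_radius

lemma mem_ball {l : ℝ} (h0 : 0 < l) (h1 : l < 1) :
    l * Real.exp (-l) ∈ Metric.eball (0 : ℝ) rr := by
  have h2 : l < Real.exp (l - 1) := by
    have := Real.add_one_lt_exp (x := l - 1) (by linarith)
    linarith
  have h3 : l * Real.exp (-l) < Real.exp (-1) := by
    calc l * Real.exp (-l) < Real.exp (l - 1) * Real.exp (-l) := by gcongr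
      _ = _ := by rw [← Real.exp_add]; ring_nf
  rw [Metric.eball_coe, Metric.mem_ball, dist_zero_right, Real.norm_of_nonneg (by positivity)]
  exact h3

lemma PP_hasSum {l : ℝ} (h0 : 0 < l) (h1 : l < 1) :
    HasSum (fun n => cc n * (l * Real.exp (-l)) ^ n) (PP.sum (l * Real.exp (-l))) := by
  have := PP_ball.hasSum (mem_ball h0 h1)
  simpa [PP, FormalMultilinearSeries.ofScalars_apply_eq, mul_comm (cc _)] using this

lemma comb (N : ℕ) :
    ∑ p ∈ Finset.HasAntidiagonal.antidiagonal N,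
      cc p.1 * ((-(p.1 : ℝ)) ^ p.2 / (p.2.factorial : ℝ)) = 1 / ((N + 1).factorial : ℝ) := by
  have h := fwdDiff_iter_eq_sum_shift (1 : ℝ) (fun r : ℝ => r ^ N) (N + 1) (-1)
  rw [fwdDiff_iter_pow_eq_zero_of_lt (Nat.lt_succ_self N)] at h
  rw [Finset.sum_range_succ'] at h
  have hs : ((-1 : ℝ)) ^ (N + 1) * (-1) ^ N = -1 := by
    rw [pow_succ, mul_right_comm, ← mul_pow]; simp
  simp only [zsmul_eq_mul, Pi.zero_apply, nsmul_eq_mul] at h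
  push_cast at h
  simp only [Nat.choose_zero_right, Nat.sub_zero, Nat.cast_one, mul_one, zero_mul, add_zero, hs,
    Nat.add_sub_add_right] at h
  rw [Finset.Nat.sum_antidiagonal_eq_sum_range_succ_mk]
  have h' : ∑ k ∈ Finset.range (N + 1), (-1 : ℝ) ^ (N - k) * ((N + 1).choose (k + 1) : ℝ)
      * (-1 + ((k : ℝ) + 1)) ^ N = 1 := by linarith
  rw [eq_div_iff (by positivity), Finset.sum_mul, ← h']
  apply Finset.sum_congr rfl
  intro k hk
  have hk' : k ≤ N := by simpa [Nat.lt_succ_iff] using hk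
  rw [Nat.cast_choose ℝ (show k + 1 ≤ N + 1 by omega), Nat.add_sub_add_right, neg_add_eq_sub,
    add_sub_cancel_right, neg_pow]
  have : (k : ℝ) ^ N = (k : ℝ) ^ k * (k : ℝ) ^ (N - k) := by
    rw [← pow_add]; congr 1; omega
  rw [this]
  unfold cc
  field_simp

lemma small {l : ℝ} (h0 : 0 < l) (h1 : l < 1 / 5) :
    l * PP.sum (l * Real.exp (-l)) = Real.exp l - 1 := by
  let f : ℕ × ℕ → ℝ := fun p => cc p.1 * l ^ (p.1 + 1) * ((-(p.1 : ℝ) * l) ^ p.2 / (p.2.factorial : ℝ))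
  have hrow (m : ℕ) : HasSum (fun j => f (m, j)) (l * (cc m * (l * Real.exp (-l)) ^ m)) := by
    have := (aux_exp (-(m : ℝ) * l)).mul_left (cc m * l ^ (m + 1))
    have e : l * (cc m * (l * Real.exp (-l)) ^ m)
        = cc m * l ^ (m + 1) * Real.exp (-(m : ℝ) * l) := by
      rw [mul_pow, ← Real.exp_nat_mul]
      ring_nf
    rw [e]
    exact this
  have hnorm (m j : ℕ) : ‖f (m, j)‖ =
      cc m * l ^ (m + 1) * (((m : ℝ) * l) ^ j / (j.factorial : ℝ)) := by
    simp only [f, norm_mul, norm_div, norm_pow, norm_neg]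
    rw [Real.norm_of_nonneg (cc_nonneg m), Real.norm_of_nonneg h0.le]
    simp
  have hnrow (m : ℕ) : HasSum (fun j => ‖f (m, j)‖)
      (cc m * l ^ (m + 1) * Real.exp ((m : ℝ) * l)) := by
    simp only [hnorm]
    exact (aux_exp ((m : ℝ) * l)).mul_left _
  have hq : Real.exp 1 * (l * Real.exp l) < 1 := by
    have e1 := Real.exp_one_lt_d9
    have e2 : Real.exp l < 1.25 := by
      have := Real.exp_bound_div_one_sub_of_interval h0.le (by linarith)
      refine this.trans_lt ?_
      rw [div_lt_iff₀ (by linarith)]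
      linarith
    calc Real.exp 1 * (l * Real.exp l) ≤ 2.7182818286 * (1 / 5 * 1.25) := by gcongr
      _ < 1 := by norm_num
  have hsum : Summable f := by
    apply Summable.of_norm
    rw [summable_prod_of_nonneg (fun p => norm_nonneg _)]
    refine ⟨fun m => (hnrow m).summable, ?_⟩
    simp only [(hnrow _).tsum_eq]
    refine Summable.of_nonneg_of_le (fun m => ?_) (fun m => ?_)
      ((summable_geometric_of_lt_one (by positivity) hq).mul_left l)
    · have := cc_nonneg m; positivity
    · have := cc_le m
      rw [mul_pow, mul_pow, Real.exp_nat_mul]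
      calc cc m * l ^ (m + 1) * Real.exp l ^ m
          ≤ Real.exp 1 ^ m * l ^ (m + 1) * Real.exp l ^ m := by gcongr
        _ = _ := by ring
  have hA : HasSum (fun m => l * (cc m * (l * Real.exp (-l)) ^ m)) (∑' p, f p) :=
    hsum.hasSum.prod_fiberwise hrow
  have hA' := (PP_hasSum h0 (by linarith)).mul_left l
  have hB : HasSum (fun N : ℕ => l ^ (N + 1) / ((N + 1).factorial : ℝ)) (∑' p, f p) := by
    have h := (Finset.HasAntidiagonal.sigmaAntidiagonalEquivProd (A := ℕ)).hasSum_iff.mpr hsum.hasSum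
    refine h.sigma (fun N => ?_)
    have h2 := hasSum_fintype (fun c : Finset.HasAntidiagonal.antidiagonal N => f c.1)
    have e : l ^ (N + 1) / ((N + 1).factorial : ℝ)
        = ∑ c : Finset.HasAntidiagonal.antidiagonal N, f c.1 := by
      rw [Finset.sum_coe_sort (Finset.HasAntidiagonal.antidiagonal N) f, div_eq_mul_one_div, ← comb N, Finset.mul_sum]
      apply Finset.sum_congr rfl
      intro p hp
      have hp' := Finset.HasAntidiagonal.mem_antidiagonal.mp hp
      simp only [f, mul_pow]
      rw [← hp']
      ring
    rw [e]
    exact h2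
  have hB' : HasSum (fun N : ℕ => l ^ (N + 1) / ((N + 1).factorial : ℝ)) (Real.exp l - 1) := by
    simpa using (hasSum_nat_add_iff' 1).mpr (aux_exp l)
  rw [hA'.unique hA, hB.unique hB']

lemma full {l : ℝ} (h0 : 0 < l) (h1 : l < 1) :
    l * PP.sum (l * Real.exp (-l)) = Real.exp l - 1 := by
  have hg : AnalyticOnNhd ℝ (fun l : ℝ => Real.exp l - 1) (Set.Ioo 0 1) := by
    intro x _; fun_prop
  have hf : AnalyticOnNhd ℝ (fun l : ℝ => l * PP.sum (l * Real.exp (-l))) (Set.Ioo 0 1) := by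
    intro x hx
    have h := PP_ball.analyticOnNhd _ (mem_ball hx.1 hx.2)
    have hi : AnalyticAt ℝ (fun l : ℝ => l * Real.exp (-l)) x := by fun_prop
    exact analyticAt_id.mul (AnalyticAt.fun_comp (f := fun l : ℝ => l * Real.exp (-l)) h hi)
  refine hf.eqOn_of_preconnected_of_eventuallyEq hg isPreconnected_Ioo
    (z₀ := 1 / 10) (by constructor <;> norm_num) ?_ ⟨h0, h1⟩
  filter_upwards [Ioo_mem_nhds (show (0 : ℝ) < 1 / 10 by norm_num)
    (show (1 / 10 : ℝ) < 1 / 5 by norm_num)] with x hx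
  exact small hx.1 hx.2


/-- The tail mass of the inter-decode-time variable `X` on `{2,3,…}` equals the
Poisson tail `P(Y ≥ 2) = 1 - (1+λ)e^{-λ}`, and the Poisson pmf sums to 1. -/
theorem stmt15 (lam : ℝ) (h0 : 0 < lam) (h1 : lam < 1) :
    (Real.exp (-lam) + lam * Real.exp (-lam)
        + ∑' k : ℕ, lam ^ (k + 2) / (Nat.factorial (k + 2)) * Real.exp (-lam) = 1) ∧
    (∑' k : ℕ, lam ^ (k + 2) / (Nat.factorial (k + 2)) * Real.exp (-lam)
        = 1 - (1 + lam) * Real.exp (-lam)) ∧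
    (∑' k : ℕ,
        ((((k + 1 : ℕ) ^ k : ℕ)) : ℝ) / (((k + 2 : ℕ) : ℝ) * (Nat.factorial k))
          * lam ^ (k + 2) * Real.exp (-((k + 2 : ℕ) : ℝ) * lam)
        = 1 - (1 + lam) * Real.exp (-lam)) := by
  have hP : HasSum (fun k : ℕ => lam ^ (k + 2) / (Nat.factorial (k + 2)) * Real.exp (-lam))
      (1 - (1 + lam) * Real.exp (-lam)) := by
    have h := ((hasSum_nat_add_iff' 2).mpr (aux_exp lam)).mul_right (Real.exp (-lam))
    have h3 : Real.exp lam * Real.exp (-lam) = 1 := by rw [← Real.exp_add]; simp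
    have e : 1 - (1 + lam) * Real.exp (-lam) = (Real.exp lam -
        ∑ i ∈ Finset.range 2, lam ^ i / (i.factorial : ℝ)) * Real.exp (-lam) := by
      simp [Finset.sum_range_succ]
      linarith
    rw [e]
    exact h
  refine ⟨by rw [hP.tsum_eq]; ring, hP.tsum_eq, ?_⟩
  have h := ((hasSum_nat_add_iff' 1).mpr (PP_hasSum h0 h1)).mul_left (lam * Real.exp (-lam))
  have hf := full h0 h1
  have he : Real.exp lam * Real.exp (-lam) = 1 := by rw [← Real.exp_add]; simp
  have hv : lam * Real.exp (-lam) * (PP.sum (lam * Real.exp (-lam)) -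
      ∑ i ∈ Finset.range 1, cc i * (lam * Real.exp (-lam)) ^ i)
      = 1 - (1 + lam) * Real.exp (-lam) := by
    simp only [Finset.sum_range_one, cc]
    norm_num
    linear_combination Real.exp (-lam) * hf + he
  rw [hv] at h
  rw [← h.tsum_eq]
  congr 1
  ext k
  have e : Real.exp (-((k + 2 : ℕ) : ℝ) * lam) = Real.exp (-lam) ^ (k + 2) := by
    rw [← Real.exp_nat_mul]; ring_nf
  rw [e]
  unfold cc
  rw [Nat.factorial_succ (k + 1), Nat.factorial_succ k]
  push_cast
  field_simp
  ring
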